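/- Let 0<s<1 and 1<p<∞ satisfy 0<sp<n. Assume that G ⊂ ℝⁿ is a uniform domain and that there exist λ with n−sp<λ≤n and C>0 such that H^λ_∞(B(x,2·dist(x,∂G)) ∩ ∂G) ≥ C · dist(x,∂G)^λ for all x ∈ G. Then G admits the (s,p)-Hardy inequality. -/

import Mathlib

open MeasureTheory Metric Set
open scoped ENNReal NNReal Topology

noncomputable section

/-- Euclidean space `ℝⁿ`. -/
abbrev Euc (n : ℕ) := EuclideanSpace ℝ (Fin n)

/-- The `λ`-Hausdorff content of a set `E ⊆ ℝⁿ`: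
`H^λ_∞(E) = inf { Σ_i r_i^λ : E ⊆ ⋃_i B(x_i, r_i), r_i > 0 }`. -/
def hContent (n : ℕ) (lam : ℝ) (E : Set (Euc n)) : ℝ≥0∞ :=
  ⨅ (c : ℕ → Euc n × ℝ) (_ : ∀ i, 0 < (c i).2)
    (_ : E ⊆ ⋃ i, Metric.ball (c i).1 (c i).2),
    ∑' i, ENNReal.ofReal ((c i).2 ^ lam)

/-- The Riesz `(s,p)`-capacity of a set `E ⊆ ℝⁿ`:
`R_{s,p}(E) = inf { ‖f‖_p^p : f ≥ 0, I_s f ≥ 1 on E }`, where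
`I_s f (x) = ∫ f(y) |x-y|^{s-n} dy`. -/
def rieszCap (n : ℕ) (s p : ℝ) (E : Set (Euc n)) : ℝ≥0∞ :=
  ⨅ (f : Euc n → ℝ) (_ : Measurable f) (_ : ∀ x, 0 ≤ f x)
    (_ : ∀ x ∈ E, 1 ≤ ∫⁻ y, ENNReal.ofReal (f y) * ENNReal.ofReal (dist x y ^ (s - (n : ℝ)))),
    ∫⁻ x, ENNReal.ofReal (f x ^ p)

/-- A set `E ⊆ ℝⁿ` is `(s,p)`-uniformly fat:
`R_{s,p}(B(x,r) ∩ E) ≥ σ r^{n-sp}` for all `x ∈ E`, `r > 0`. -/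
def UniformlyFat (n : ℕ) (s p : ℝ) (E : Set (Euc n)) : Prop :=
  ∃ σ : ℝ, 0 < σ ∧ ∀ x ∈ E, ∀ r : ℝ, 0 < r →
    ENNReal.ofReal (σ * r ^ ((n : ℝ) - s * p)) ≤ rieszCap n s p (Metric.ball x r ∩ E)

/-- A set `E ⊆ ℝⁿ` is locally `(s,p)`-uniformly fat:
`R_{s,p}(B(x,r) ∩ E) ≥ σ r^{n-sp}` for all `x ∈ E`, `0 < r < r₀`. -/
def LocallyUniformlyFat (n : ℕ) (s p : ℝ) (E : Set (Euc n)) : Prop :=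
  ∃ σ r₀ : ℝ, 0 < σ ∧ 0 < r₀ ∧ ∀ x ∈ E, ∀ r : ℝ, 0 < r → r < r₀ →
    ENNReal.ofReal (σ * r ^ ((n : ℝ) - s * p)) ≤ rieszCap n s p (Metric.ball x r ∩ E)

/-- An open set `G ⊆ ℝⁿ` admits the `(s,p)`-Hardy inequality:
`∫_G |u|^p dist(x,∂G)^{-sp} dx ≤ c ∫_G ∫_G |u(x)-u(y)|^p |x-y|^{-(n+sp)} dy dx`
for every `u ∈ C_c^∞(G)`. -/
def AdmitsHardy (n : ℕ) (s p : ℝ) (G : Set (Euc n)) : Prop :=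
  ∃ c : ℝ, 0 < c ∧ ∀ u : Euc n → ℝ,
    ContDiff ℝ (⊤ : ℕ∞) u → HasCompactSupport u → tsupport u ⊆ G →
    (∫⁻ x in G, ENNReal.ofReal (|u x| ^ p / Metric.infDist x (frontier G) ^ (s * p))) ≤
      ENNReal.ofReal c *
        ∫⁻ x in G, ∫⁻ y in G, ENNReal.ofReal (|u x - u y| ^ p / dist x y ^ ((n : ℝ) + s * p))

/-- `U` is a `c`-John domain with center point `x₀`: every `x ∈ U` is joined to `x₀`
by an arc-length-parameterized (here: 1-Lipschitz) curve `γ : [0,ℓ] → U` with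
`dist(γ(t), ∂U) ≥ t/c`. -/
def IsJohnDomain (n : ℕ) (c : ℝ) (U : Set (Euc n)) (x₀ : Euc n) : Prop :=
  IsOpen U ∧ IsConnected U ∧ x₀ ∈ U ∧
  ∀ x ∈ U, ∃ ℓ : ℝ, 0 ≤ ℓ ∧ ∃ γ : ℝ → Euc n,
    LipschitzOnWith 1 γ (Set.Icc 0 ℓ) ∧ γ 0 = x ∧ γ ℓ = x₀ ∧
    ∀ t ∈ Set.Icc 0 ℓ, γ t ∈ U ∧ t / c ≤ Metric.infDist (γ t) (frontier U)

/-- `G_{x,c}`: the union of all `c`-John subdomains of `G` with center point `x`. -/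
def johnPart (n : ℕ) (c : ℝ) (G : Set (Euc n)) (x : Euc n) : Set (Euc n) :=
  ⋃₀ {U : Set (Euc n) | U ⊆ G ∧ IsJohnDomain n c U x}

/-- The `c`-visual boundary of `G` near `x`: `∂^vis_{x,c} G = ∂G ∩ ∂G_{x,c}`. -/
def visualBoundary (n : ℕ) (c : ℝ) (G : Set (Euc n)) (x : Euc n) : Set (Euc n) :=
  frontier G ∩ frontier (johnPart n c G x)

/-- `G` is a uniform domain with constant `C`. -/
def IsUniformDomain (n : ℕ) (C : ℝ) (G : Set (Euc n)) : Prop :=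
  IsOpen G ∧ IsConnected G ∧
  ∀ x ∈ G, ∀ y ∈ G, ∃ ℓ : ℝ, 0 ≤ ℓ ∧ ℓ ≤ C * dist x y ∧
    ∃ γ : ℝ → Euc n, LipschitzOnWith 1 γ (Set.Icc 0 ℓ) ∧ γ 0 = x ∧ γ ℓ = y ∧
      ∀ t ∈ Set.Icc 0 ℓ, γ t ∈ G ∧
        min (dist (γ t) x) (dist (γ t) y) / C ≤ Metric.infDist (γ t) (frontier G)

/-- The closed axis-parallel cube with center `z` and side length `ℓ`. -/
def cube (n : ℕ) (z : Euc n) (ℓ : ℝ) : Set (Euc n) := {y | ∀ i, |y i - z i| ≤ ℓ / 2}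

/-- Distance between two sets. -/
def setSetDist (n : ℕ) (A B : Set (Euc n)) : ℝ := sInf (Set.image2 dist A B)

/-- `Q = cube z ℓ` is a Whitney cube of the open set `G`:
`Q ⊆ G` and `diam Q ≤ dist(Q, ∂G) ≤ 4 diam Q`. -/
def IsWhitneyCube (n : ℕ) (G : Set (Euc n)) (z : Euc n) (ℓ : ℝ) : Prop :=
  0 < ℓ ∧ cube n z ℓ ⊆ G ∧
    Metric.diam (cube n z ℓ) ≤ setSetDist n (cube n z ℓ) (frontier G) ∧
    setSetDist n (cube n z ℓ) (frontier G) ≤ 4 * Metric.diam (cube n z ℓ)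

/-- The `p`-th power of the Gagliardo `(s,p)`-seminorm of `u` on `A`:
`|u|_{W^{s,p}(A)}^p = ∫_A ∫_A |u(x)-u(y)|^p |x-y|^{-(n+sp)} dy dx`. -/
def gagliardoP (n : ℕ) (s p : ℝ) (A : Set (Euc n)) (u : Euc n → ℝ) : ℝ≥0∞ :=
  ∫⁻ x in A, ∫⁻ y in A, ENNReal.ofReal (|u x - u y| ^ p / dist x y ^ ((n : ℝ) + s * p))

/-- `E` is an Ahlfors `λ`-regular set: `E` is closed and
`C⁻¹ r^λ ≤ H^λ(B(x,r) ∩ E) ≤ C r^λ` for `x ∈ E`, `0 < r < diam E`. -/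
def AhlforsRegular (n : ℕ) (lam : ℝ) (E : Set (Euc n)) : Prop :=
  IsClosed E ∧ ∃ C : ℝ, 1 < C ∧ ∀ x ∈ E, ∀ r : ℝ, 0 < r →
    ENNReal.ofReal r < EMetric.diam E →
      ENNReal.ofReal (C⁻¹ * r ^ lam) ≤ μH[lam] (Metric.ball x r ∩ E) ∧
      μH[lam] (Metric.ball x r ∩ E) ≤ ENNReal.ofReal (C * r ^ lam)

lemma hContent_le_tsum {n : ℕ} {lam : ℝ} (hlam : 0 < lam) {E : Set (Euc n)} {ι : Type*}
    [Countable ι] (c : ι → Euc n) (r : ι → ℝ) (hr : ∀ i, 0 < r i)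
    (hE : E ⊆ ⋃ i, Metric.ball (c i) (r i)) :
    hContent n lam E ≤ ∑' i, ENNReal.ofReal (r i ^ lam) := by
  refine ENNReal.le_of_forall_pos_le_add fun ε hε _ => ?_
  obtain ⟨e, he0, he⟩ := ENNReal.exists_pos_sum_of_countable
    (ε := (ε : ℝ≥0∞)) (by exact_mod_cast hε.ne') ℕ
  have : Infinite (ι ⊕ ℕ) := inferInstance
  have : Countable (ι ⊕ ℕ) := inferInstance
  obtain ⟨φ⟩ := nonempty_equiv_of_countable (α := ℕ) (β := ι ⊕ ℕ)
  let f : ι ⊕ ℕ → Euc n × ℝ :=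
    Sum.elim (fun i => (c i, r i)) (fun k => (0, (e k : ℝ) ^ lam⁻¹))
  refine (iInf_le_of_le (fun k => f (φ k)) ?_).trans (b := ∑' k, ENNReal.ofReal ((f (φ k)).2 ^ lam)) ?_
  · refine iInf_le_of_le (fun k => ?_) (iInf_le_of_le (fun x hx => ?_) le_rfl)
    · show 0 < (f (φ k)).2
      rcases φ k with i | i
      · exact hr i
      · exact Real.rpow_pos_of_pos (NNReal.coe_pos.2 (he0 i)) _
    · obtain ⟨i, hi⟩ := mem_iUnion.1 (hE hx)
      exact mem_iUnion.2 ⟨φ.symm (Sum.inl i), by simpa [f] using hi⟩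
  · rw [φ.tsum_eq (fun k => ENNReal.ofReal ((f k).2 ^ lam)),
      Summable.tsum_sum ENNReal.summable ENNReal.summable]
    refine add_le_add le_rfl (le_trans (le_of_eq (tsum_congr fun k => ?_)) he.le)
    simp only [f, Sum.elim_inr]
    rw [← Real.rpow_mul (by positivity), inv_mul_cancel₀ hlam.ne', Real.rpow_one]
    simp

lemma volume_ball_eq {n : ℕ} (z : Euc n) {r : ℝ} (hr : 0 < r) :
    volume (Metric.ball z r) = ENNReal.ofReal (r ^ n * volume.real (Metric.ball (0 : Euc n) 1)) := by
  rw [Measure.addHaar_ball_of_pos _ _ hr, finrank_euclideanSpace_fin,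
    ENNReal.ofReal_mul (by positivity), measureReal_def, ENNReal.ofReal_toReal measure_ball_lt_top.ne]

lemma volume_real_unit_ball_pos (n : ℕ) : 0 < volume.real (Metric.ball (0 : Euc n) 1) :=
  ENNReal.toReal_pos (measure_ball_pos _ _ one_pos).ne' measure_ball_lt_top.ne

/-- Jensen's inequality for the average over a ball. -/
lemma abs_sub_average_rpow_le {n : ℕ} {p : ℝ} (hp : 1 < p) {u : Euc n → ℝ} (hu : Continuous u)
    (c : ℝ) (z : Euc n) {r : ℝ} (hr : 0 < r) :
    ENNReal.ofReal (|c - ⨍ y in Metric.ball z r, u y| ^ p) * volume (Metric.ball z r) ≤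
      ∫⁻ y in Metric.ball z r, ENNReal.ofReal (|c - u y| ^ p) := by
  have hInt : ∀ f : Euc n → ℝ, Continuous f → IntegrableOn f (Metric.ball z r) := fun f hf =>
    (hf.continuousOn.integrableOn_compact (isCompact_closedBall z r)).mono_set
      Metric.ball_subset_closedBall
  have hcont : Continuous fun t : ℝ => |t| ^ p :=
    continuous_abs.rpow_const fun _ => Or.inr (by linarith)
  have hconv : ConvexOn ℝ univ fun t : ℝ => |t| ^ p := by
    refine ⟨convex_univ, fun x _ y _ a b ha hb hab => ?_⟩
    refine le_trans (Real.rpow_le_rpow (abs_nonneg _) ?_ (by linarith))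
      ((convexOn_rpow hp.le).2 (abs_nonneg x) (abs_nonneg y) ha hb hab)
    simpa [abs_mul, abs_of_nonneg ha, abs_of_nonneg hb] using abs_add_le (a * x) (b * y)
  have h0 := (measure_ball_pos volume z hr).ne'
  have ht : volume (Metric.ball z r) ≠ ∞ := measure_ball_lt_top.ne
  have hcu : Continuous fun y => c - u y := continuous_const.sub hu
  have key := hconv.map_set_average_le (μ := volume) (t := Metric.ball z r) (f := fun y => c - u y)
    hcont.continuousOn isClosed_univ h0 ht
    (by simp) (hInt _ hcu) (hInt _ (hcont.comp hcu))
  have hav : ⨍ y in Metric.ball z r, (c - u y) = c - ⨍ y in Metric.ball z r, u y := by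
    rw [setAverage_eq, setAverage_eq, integral_sub (hInt _ continuous_const) (hInt _ hu), smul_sub,
      setIntegral_const, smul_smul, inv_mul_cancel₀ (measureReal_ne_zero_iff ht |>.2 h0), one_smul]
  simp only [hav] at key
  rw [setAverage_eq (f := fun x => |c - u x| ^ p), smul_eq_mul] at key
  have hV : 0 < volume.real (Metric.ball z r) := ENNReal.toReal_pos h0 ht
  rw [← ofReal_integral_eq_lintegral_ofReal (f := fun y => |c - u y| ^ p)
    (hInt _ (hcont.comp hcu))
    (Filter.Eventually.of_forall fun y => by positivity),
    ← ENNReal.ofReal_toReal ht, ← ENNReal.ofReal_mul (by positivity)]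
  refine ENNReal.ofReal_le_ofReal ?_
  rwa [inv_mul_eq_div, le_div_iff₀ hV] at key

lemma exists_geometric_step {U : ℕ → ℝ} {N : ℕ} (hN : U N = 0) {q : ℝ} (hq : 0 < q) :
    ∃ k, |U 0| * (1 - q) * q ^ k ≤ |U k - U (k + 1)| := by
  by_contra! h
  have hk : ∀ k, |U 0| * q ^ k ≤ |U k| := by
    intro k
    induction k with
    | zero => simp
    | succ k ih =>
      have := h k
      have := abs_sub_abs_le_abs_sub (U k) (U (k + 1))
      rw [pow_succ]
      nlinarith
  have h1 := hk N
  rw [hN, abs_zero] at h1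
  have h2 : |U 0| = 0 :=
    le_antisymm (nonpos_of_mul_nonpos_left h1 (by positivity)) (abs_nonneg _)
  have := h 0
  rw [h2] at this
  linarith [abs_nonneg (U 0 - U (0 + 1))]

lemma ball_infDist_frontier_subset {n : ℕ} {G : Set (Euc n)} (hG : IsOpen G) {z : Euc n}
    (hz : z ∈ G) : Metric.ball z (Metric.infDist z (frontier G)) ⊆ G := by
  rcases (Metric.ball z (Metric.infDist z (frontier G))).eq_empty_or_nonempty with he | hne
  · simp [he]
  refine (convex_ball z _).isPreconnected.subset_left_of_subset_union hG
    (isClosed_closure (s := G)).isOpen_compl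
    (disjoint_compl_right_iff_subset.2 subset_closure) (fun y hy => ?_)
    ⟨z, Metric.mem_ball_self (Metric.nonempty_ball.1 hne), hz⟩
  by_contra h
  simp only [mem_union, mem_compl_iff, not_or, not_not] at h
  have := Metric.infDist_le_dist_of_mem (x := z) (hG.frontier_eq ▸ ⟨h.2, h.1⟩ : y ∈ frontier G)
  rw [Metric.mem_ball, dist_comm] at hy
  linarith

lemma exists_eq_zero_near_frontier {n : ℕ} {G : Set (Euc n)} (hG : IsOpen G)
    (hne : (frontier G).Nonempty) {u : Euc n → ℝ} (hu : HasCompactSupport u)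
    (hs : tsupport u ⊆ G) :
    ∃ η, 0 < η ∧ ∀ y, Metric.infDist y (frontier G) < η → u y = 0 := by
  obtain ⟨η, hη, h⟩ := IsCompact.exists_thickening_subset_open hu hG hs
  refine ⟨η, hη, fun y hy => ?_⟩
  by_contra hy0
  obtain ⟨w, hw, hyw⟩ := (Metric.infDist_lt_iff hne).1 hy
  have : w ∈ G := h (Metric.mem_thickening_iff.2 ⟨y, subset_tsupport u hy0, by rwa [dist_comm]⟩)
  exact (hG.inter_frontier_eq.subset ⟨this, hw⟩).elim

/-- Interior corkscrew points in uniform domains. -/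
lemma IsUniformDomain.exists_corkscrew {n : ℕ} {C : ℝ} (hC : 1 ≤ C) {G : Set (Euc n)}
    (h : IsUniformDomain n C G) {x w : Euc n} (hx : x ∈ G) (hw : w ∈ frontier G) {r : ℝ}
    (hr : 0 < r) (hrx : 2 * r ≤ dist x w) :
    ∃ z ∈ G, dist z w = r ∧ 3 * r / (4 * C) ≤ Metric.infDist z (frontier G) := by
  obtain ⟨y, hy, hyw⟩ := Metric.mem_closure_iff.1 (frontier_subset_closure hw) (r / 4) (by positivity)
  obtain ⟨ℓ, hℓ, -, γ, hγ, h0, h1, hγG⟩ := h.2.2 y hy x hx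
  have hcont : ContinuousOn (fun t => dist (γ t) w) (Set.Icc 0 ℓ) :=
    (continuous_id.dist continuous_const).comp_continuousOn hγ.continuousOn
  rw [dist_comm] at hyw
  obtain ⟨t, ht, htr⟩ := intermediate_value_Icc hℓ hcont
    (show r ∈ Set.Icc _ _ by simp only [h0, h1]; constructor <;> linarith)
  simp only at htr
  refine ⟨γ t, (hγG t ht).1, htr, le_trans ?_ (hγG t ht).2⟩
  have e1 := dist_triangle (γ t) y w
  have e2 := dist_triangle x (γ t) w
  rw [dist_comm x (γ t)] at e2
  rw [← div_div]
  gcongr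
  exact le_min (by linarith) (by linarith)

/-- The inner integral of the Gagliardo seminorm, as a function of the outer variable. -/
def gagliardoDensity (n : ℕ) (s p : ℝ) (G : Set (Euc n)) (u : Euc n → ℝ) (x : Euc n) : ℝ≥0∞ :=
  ∫⁻ y in G, ENNReal.ofReal (|u x - u y| ^ p / dist x y ^ ((n : ℝ) + s * p))

lemma measurable_gagliardoDensity {n : ℕ} {s p : ℝ} {G : Set (Euc n)} {u : Euc n → ℝ}
    (hu : Continuous u) : Measurable (gagliardoDensity n s p G u) := by
  have hm := hu.measurable
  refine Measurable.lintegral_prod_right' (f := fun z : Euc n × Euc n =>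
    ENNReal.ofReal (|u z.1 - u z.2| ^ p / dist z.1 z.2 ^ ((n : ℝ) + s * p))) ?_
  have h1 : Measurable fun z : Euc n × Euc n => dist z.1 z.2 := continuous_dist.measurable
  have h2 : Measurable fun z : Euc n × Euc n => |u z.1 - u z.2| :=
    (continuous_abs.comp
      ((hu.comp continuous_fst).sub (hu.comp continuous_snd))).measurable
  exact ((h2.pow_const p).div (h1.pow_const _)).ennreal_ofReal

lemma abs_sub_average_rpow_le_gagliardoDensity {n : ℕ} {s p : ℝ} (hp : 1 < p) (hsp : 0 < s * p)
    {G : Set (Euc n)} {u : Euc n → ℝ} (hu : Continuous u) (x z : Euc n) {r K : ℝ} (hr : 0 < r)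
    (hzG : Metric.ball z r ⊆ G) (hK : ∀ y ∈ Metric.ball z r, dist x y ≤ K) :
    ENNReal.ofReal (|u x - ⨍ y in Metric.ball z r, u y| ^ p) * volume (Metric.ball z r) ≤
      ENNReal.ofReal (K ^ ((n : ℝ) + s * p)) * gagliardoDensity n s p G u x := by
  have hK0 : 0 ≤ K := dist_nonneg.trans (hK z (Metric.mem_ball_self hr))
  calc _ ≤ _ := abs_sub_average_rpow_le hp hu (u x) z hr
    _ ≤ ∫⁻ y in Metric.ball z r, ENNReal.ofReal (K ^ ((n : ℝ) + s * p)) *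
          ENNReal.ofReal (|u x - u y| ^ p / dist x y ^ ((n : ℝ) + s * p)) := by
        refine setLIntegral_mono' measurableSet_ball fun y hy => ?_
        rw [← ENNReal.ofReal_mul (by positivity)]
        refine ENNReal.ofReal_le_ofReal ?_
        rcases eq_or_ne x y with rfl | hxy
        · rw [sub_self, abs_zero, Real.zero_rpow (by linarith)]
          positivity
        · have hd : 0 < dist x y := dist_pos.2 hxy
          rw [mul_div_assoc', le_div_iff₀ (by positivity), mul_comm]
          gcongr
          exact hK y hy
    _ = ENNReal.ofReal (K ^ ((n : ℝ) + s * p)) * ∫⁻ y in Metric.ball z r,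
          ENNReal.ofReal (|u x - u y| ^ p / dist x y ^ ((n : ℝ) + s * p)) :=
        lintegral_const_mul' _ _ ENNReal.ofReal_ne_top
    _ ≤ _ := by
        gcongr
        exact lintegral_mono_set hzG

lemma average_sub_average_rpow_le_gagliardoDensity {n : ℕ} {s p : ℝ} (hp : 1 < p)
    (hsp : 0 < s * p) {G : Set (Euc n)} {u : Euc n → ℝ} (hu : Continuous u) (a b : Euc n)
    {r r' K : ℝ} (hr : 0 < r) (hr' : 0 < r') (hbG : Metric.ball b r' ⊆ G)
    (hK : ∀ x ∈ Metric.ball a r, ∀ y ∈ Metric.ball b r', dist x y ≤ K) :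
    ENNReal.ofReal (|(⨍ y in Metric.ball a r, u y) - ⨍ y in Metric.ball b r', u y| ^ p) *
        volume (Metric.ball a r) * volume (Metric.ball b r') ≤
      ENNReal.ofReal (K ^ ((n : ℝ) + s * p)) *
        ∫⁻ x in Metric.ball a r, gagliardoDensity n s p G u x := by
  rw [abs_sub_comm]
  refine (mul_le_mul_left (abs_sub_average_rpow_le hp hu _ a hr) _).trans ?_
  rw [← lintegral_mul_const' _ _ measure_ball_lt_top.ne,
    ← lintegral_const_mul' _ _ ENNReal.ofReal_ne_top]
  refine setLIntegral_mono' measurableSet_ball fun x hx => ?_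
  rw [abs_sub_comm]
  exact abs_sub_average_rpow_le_gagliardoDensity hp hsp hu x b hr' hbG (hK x hx)

/-- A covering argument: a measure which is large on some ball around each point of `E`
dominates the Hausdorff content of `E`. -/
lemma mul_hContent_le_measure {n : ℕ} {lam : ℝ} (hlam : 0 < lam) {E S : Set (Euc n)}
    (ν : Measure (Euc n)) {R : ℝ} {t : ℝ≥0∞}
    (h : ∀ w ∈ E, ∃ r, 0 < r ∧ r ≤ R ∧ Metric.closedBall w r ⊆ S ∧
      t * ENNReal.ofReal (r ^ lam) ≤ ν (Metric.closedBall w r)) :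
    t * hContent n lam E ≤ ENNReal.ofReal (6 ^ lam) * ν S := by
  choose! r hr0 hrR hrS hr using h
  obtain ⟨v, hvE, hdisj, hcov⟩ := Vitali.exists_disjoint_subfamily_covering_enlargement_closedBall
    E id r R hrR 5 (by norm_num)
  simp only [id] at hdisj hcov
  have hcount : v.Countable := hdisj.countable_of_nonempty_interior fun i hi =>
    ⟨i, Metric.ball_subset_interior_closedBall (Metric.mem_ball_self (hr0 i (hvE hi)))⟩
  have := hcount.to_subtype
  have hle := hContent_le_tsum hlam (E := E) (ι := v) (fun i => i) (fun i => 6 * r i)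
    (fun i => by have := hr0 i (hvE i.2); positivity) (fun w hw => by
      obtain ⟨b, hb, hwb⟩ := hcov w hw
      have := hr0 b (hvE hb)
      refine mem_iUnion.2 ⟨⟨b, hb⟩, Metric.closedBall_subset_ball (by linarith)
        (hwb (Metric.mem_closedBall_self (hr0 w hw).le))⟩)
  calc t * hContent n lam E ≤ t * ∑' i : v, ENNReal.ofReal ((6 * r i) ^ lam) := by gcongr
    _ = ENNReal.ofReal (6 ^ lam) * ∑' i : v, t * ENNReal.ofReal (r i ^ lam) := by
        rw [← ENNReal.tsum_mul_left, ← ENNReal.tsum_mul_left]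
        refine tsum_congr fun i => ?_
        rw [Real.mul_rpow (by norm_num) (hr0 i (hvE i.2)).le,
          ENNReal.ofReal_mul (by positivity)]
        ring
    _ ≤ ENNReal.ofReal (6 ^ lam) * ∑' i : v, ν (Metric.closedBall (i : Euc n) (r i)) := by
        gcongr with i
        exact hr i (hvE i.2)
    _ = ENNReal.ofReal (6 ^ lam) * ν (⋃ i : v, Metric.closedBall (i : Euc n) (r i)) := by
        rw [measure_iUnion (hdisj.subtype) fun i => measurableSet_closedBall]
    _ ≤ ENNReal.ofReal (6 ^ lam) * ν S := by
        gcongr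
        exact iUnion_subset fun i => hrS i (hvE i.2)

lemma exists_lintegral_add_dist_rpow_le (n : ℕ) {δ : ℝ} (hδ : 0 < δ) :
    ∃ K : ℝ, 0 ≤ K ∧ ∀ t : ℝ, 0 < t → ∀ y : Euc n,
      ∫⁻ x, ENNReal.ofReal ((t + dist x y) ^ (-((n : ℝ) + δ))) ≤ ENNReal.ofReal (K * t ^ (-δ)) := by
  set J : ℝ≥0∞ := ∫⁻ x : Euc n, ENNReal.ofReal ((1 + ‖x‖) ^ (-((n : ℝ) + δ))) with hJ
  have hJ' : J < ∞ := finite_integral_one_add_norm (by simpa using hδ)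
  refine ⟨J.toReal, ENNReal.toReal_nonneg, fun t ht y => le_of_eq ?_⟩
  have hm : Measurable fun x : Euc n => ENNReal.ofReal ((1 + ‖x‖) ^ (-((n : ℝ) + δ))) := by
    fun_prop
  have h1 : ∫⁻ x : Euc n, ENNReal.ofReal ((1 + ‖t⁻¹ • x‖) ^ (-((n : ℝ) + δ))) =
      ENNReal.ofReal (t ^ n) * J := by
    rw [hJ, ← lintegral_map (μ := volume) (g := fun x : Euc n => t⁻¹ • x) hm
      (measurable_const_smul _), Measure.map_addHaar_smul _ (inv_ne_zero ht.ne'),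
      lintegral_smul_measure, finrank_euclideanSpace_fin, inv_pow, inv_inv,
      abs_of_pos (by positivity), smul_eq_mul]
  have h2 : ∀ x : Euc n, ENNReal.ofReal ((t + ‖x‖) ^ (-((n : ℝ) + δ))) =
      ENNReal.ofReal (t ^ (-((n : ℝ) + δ))) *
        ENNReal.ofReal ((1 + ‖t⁻¹ • x‖) ^ (-((n : ℝ) + δ))) := by
    intro x
    rw [← ENNReal.ofReal_mul (by positivity), ← Real.mul_rpow ht.le (by positivity), norm_smul,
      norm_inv, Real.norm_of_nonneg ht.le]
    congr 2
    field_simp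
  simp only [dist_eq_norm]
  rw [lintegral_sub_right_eq_self (fun x : Euc n => ENNReal.ofReal ((t + ‖x‖) ^ (-((n : ℝ) + δ)))) y]
  simp only [h2]
  rw [lintegral_const_mul' _ _ ENNReal.ofReal_ne_top, h1, ← mul_assoc,
    ← ENNReal.ofReal_mul (by positivity), ← Real.rpow_natCast t n, ← Real.rpow_add ht, mul_comm,
    ENNReal.ofReal_mul ENNReal.toReal_nonneg, ENNReal.ofReal_toReal hJ'.ne]
  congr 3
  ring

/-- The average of `u` over the ball centered at `x` with radius comparable to the distance to
the boundary of `G`, with `C` the uniformity constant. -/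
def innerAverage (n : ℕ) (C : ℝ) (G : Set (Euc n)) (u : Euc n → ℝ) (x : Euc n) : ℝ :=
  ⨍ y in Metric.ball x (1 / (4 * C) * Metric.infDist x (frontier G)), u y

/-- The Gagliardo density with a weight given by a power of the distance to the boundary. -/
def weightedDensity (n : ℕ) (s p δ : ℝ) (G : Set (Euc n)) (u : Euc n → ℝ) (x : Euc n) : ℝ≥0∞ :=
  gagliardoDensity n s p G u x * ENNReal.ofReal (Metric.infDist x (frontier G) ^ δ)

lemma infDist_frontier_pos {n : ℕ} {G : Set (Euc n)} (hG : IsOpen G)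
    (hne : (frontier G).Nonempty) {x : Euc n} (hx : x ∈ G) : 0 < Metric.infDist x (frontier G) :=
  (isClosed_frontier.notMem_iff_infDist_pos hne).1
    fun h => (hG.inter_frontier_eq.subset ⟨hx, h⟩).elim

/-- Chaining towards a boundary point through corkscrew balls. -/
lemma exists_radius_innerAverage_rpow_le {n : ℕ} {s p Cu δ : ℝ} (hp : 1 < p) (hsp : 0 < s * p)
    (hCu : 1 ≤ Cu) (hδ : 0 < δ) {G : Set (Euc n)} (hG : IsUniformDomain n Cu G)
    (hne : (frontier G).Nonempty) :
    ∃ c : ℝ, 0 < c ∧ ∀ u : Euc n → ℝ, Continuous u → ∀ η : ℝ, 0 < η →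
      (∀ y, Metric.infDist y (frontier G) < η → u y = 0) →
      ∀ x ∈ G, ∀ w ∈ frontier G, dist x w < 2 * Metric.infDist x (frontier G) →
      ∃ r : ℝ, 0 < r ∧ r ≤ 3 * Metric.infDist x (frontier G) ∧
        ENNReal.ofReal (c * (|innerAverage n Cu G u x| ^ p * r ^ ((n : ℝ) - s * p + 2 * δ) *
          Metric.infDist x (frontier G) ^ (-δ))) ≤
        ∫⁻ y in Metric.closedBall w r ∩ G, weightedDensity n s p δ G u y := by
  set ω := volume.real (Metric.ball (0 : Euc n) 1) with hω
  have hω0 : 0 < ω := volume_real_unit_ball_pos n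
  set β := 1 / (4 * Cu) with hβ
  have hβ0 : 0 < β := by positivity
  have hβ1 : β ≤ 1 / 4 := by
    rw [hβ]; gcongr; linarith
  set q : ℝ := (2 : ℝ) ^ (-δ / p) with hq
  have hq0 : 0 < q := by positivity
  have hq1 : q < 1 := Real.rpow_lt_one_of_one_lt_of_neg (by norm_num)
    (div_neg_of_neg_of_pos (by linarith) (by linarith))
  have hq1' : 0 < 1 - q := by linarith
  set lam := (n : ℝ) - s * p + 2 * δ with hlam
  set e := (n : ℝ) + s * p with he
  have he0 : 0 < e := by positivity
  set c := (1 - q) ^ p * (ω ^ 2 * (β ^ 2 / 2) ^ n) * (1 / (2 * Cu)) ^ δ / (6 ^ e * 3 ^ lam) with hc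
  refine ⟨c, by positivity, fun u hu η hη huη x hx w hw hxw => ?_⟩
  set d := Metric.infDist x (frontier G) with hd
  have hd0 : 0 < d := infDist_frontier_pos hG.1 hne hx
  have hdw : d ≤ dist x w := Metric.infDist_le_dist_of_mem hw
  have hz : ∀ k : ℕ, ∃ z ∈ G, (k = 0 → z = x) ∧ dist z w ≤ 2 * (d / 2 ^ k) ∧
      3 * (d / 2 ^ k) / (4 * Cu) ≤ Metric.infDist z (frontier G) := by
    intro k
    rcases k with _ | k
    · refine ⟨x, hx, fun _ => rfl, by simpa using hxw.le, ?_⟩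
      rw [← hd, div_le_iff₀ (by positivity), pow_zero, div_one]
      nlinarith
    · have h2 : (1 : ℝ) ≤ 2 ^ k := one_le_pow₀ (by norm_num)
      obtain ⟨z, hz, hzw, hzd⟩ := hG.exists_corkscrew hCu hx hw (r := d / 2 ^ (k + 1))
        (by positivity) (le_trans (by rw [pow_succ]; field_simp; linarith) hdw)
      exact ⟨z, hz, by simp, by rw [hzw]; linarith [show 0 < d / 2 ^ (k + 1) by positivity], hzd⟩
  choose z hzG hz0 hzw hzd using hz
  have hzx : z 0 = x := hz0 0 rfl
  set ρ : ℕ → ℝ := fun k => d / 2 ^ k with hρ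
  have hρ0 : ∀ k, 0 < ρ k := fun k => by positivity
  have hρs : ∀ k, ρ (k + 1) = ρ k / 2 := fun k => by simp only [hρ, pow_succ]; field_simp
  have hyw : ∀ k, ∀ y ∈ Metric.ball (z k) (β * ρ k), dist y w ≤ 3 * ρ k := by
    intro k y hy
    have := dist_triangle y (z k) w
    have := Metric.mem_ball.1 hy
    have := hzw k
    have := hρ0 k
    nlinarith
  have hyd : ∀ k, ∀ y ∈ Metric.ball (z k) (β * ρ k),
      1 / (2 * Cu) * ρ k ≤ Metric.infDist y (frontier G) := by
    intro k y hy
    have h1 := Metric.infDist_le_infDist_add_dist (s := frontier G) (x := z k) (y := y)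
    have h2 := Metric.mem_ball'.1 hy
    have h3 := hzd k
    have h4 : 3 * (d / 2 ^ k) / (4 * Cu) = 1 / (2 * Cu) * ρ k + β * ρ k := by
      simp only [hρ, hβ]
      field_simp
      norm_num
    linarith
  have hbG : ∀ k, Metric.ball (z k) (β * ρ k) ⊆ G := by
    intro k
    refine (Metric.ball_subset_ball ?_).trans (ball_infDist_frontier_subset hG.1 (hzG k))
    refine le_trans ?_ (hzd k)
    have := hρ0 k
    calc β * ρ k = 1 * ρ k / (4 * Cu) := by rw [hβ]; ring
      _ ≤ 3 * ρ k / (4 * Cu) := by gcongr; norm_num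
  set U : ℕ → ℝ := fun k => ⨍ y in Metric.ball (z k) (β * ρ k), u y with hU
  have hU0 : U 0 = innerAverage n Cu G u x := by
    simp only [hU, hρ, innerAverage, hzx, pow_zero, div_one, hβ, hd]
  obtain ⟨N, hN⟩ : ∃ N, U N = 0 := by
    obtain ⟨N, hN⟩ := exists_pow_lt_of_lt_one (show 0 < η / (3 * d) by positivity)
      (show (1 / 2 : ℝ) < 1 by norm_num)
    refine ⟨N, ?_⟩
    simp only [hU]
    rw [setAverage_eq, setIntegral_eq_zero_of_forall_eq_zero, smul_zero]
    intro y hy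
    refine huη y ((Metric.infDist_le_dist_of_mem hw).trans_lt ((hyw N y hy).trans_lt ?_))
    rw [lt_div_iff₀ (by positivity)] at hN
    simp only [hρ]
    calc 3 * (d / 2 ^ N) = (1 / 2) ^ N * (3 * d) := by rw [one_div, inv_pow]; ring
      _ < η := hN
  obtain ⟨k, hk⟩ := exists_geometric_step hN hq0
  set r := ρ k with hr
  have hr0 : 0 < r := hρ0 k
  refine ⟨3 * r, by positivity, ?_, ?_⟩
  · have : r ≤ d := div_le_self hd0.le (one_le_pow₀ (by norm_num))
    linarith
  have hchain := average_sub_average_rpow_le_gagliardoDensity hp hsp hu (z k) (z (k + 1))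
    (r := β * ρ k) (r' := β * ρ (k + 1)) (K := 6 * r) (by positivity)
    (mul_pos hβ0 (hρ0 _)) (hbG (k + 1)) (by
      intro a ha b hb
      have h1 := hyw k a ha
      have h2 := hyw (k + 1) b hb
      have h3 := dist_triangle_right a b w
      rw [hρs] at h2
      linarith)
  have hweight : (∫⁻ y in Metric.ball (z k) (β * ρ k), gagliardoDensity n s p G u y) *
      ENNReal.ofReal ((1 / (2 * Cu) * r) ^ δ) ≤
      ∫⁻ y in Metric.closedBall w (3 * r) ∩ G, weightedDensity n s p δ G u y := by
    rw [← lintegral_mul_const' _ _ ENNReal.ofReal_ne_top]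
    refine (setLIntegral_mono' measurableSet_ball fun y hy => ?_).trans
      (lintegral_mono_set (subset_inter (fun y hy => hyw k y hy) (hbG k)))
    simp only [weightedDensity]
    gcongr
    exact hyd k y hy
  rw [volume_ball_eq _ (by positivity), volume_ball_eq _ (mul_pos hβ0 (hρ0 _)),
    ← ENNReal.ofReal_mul (by positivity), ← ENNReal.ofReal_mul (by positivity), ← hω] at hchain
  have h6 : ENNReal.ofReal ((6 * r) ^ e) ≠ 0 := by
    rw [ENNReal.ofReal_ne_zero_iff]; positivity
  refine (ENNReal.mul_le_mul_iff_right h6 ENNReal.ofReal_ne_top).1 ?_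
  refine le_trans ?_ (mul_le_mul_right hweight _)
  refine le_trans ?_ ((mul_le_mul_left hchain _).trans_eq (mul_assoc _ _ _))
  rw [← ENNReal.ofReal_mul (by positivity), ← ENNReal.ofReal_mul (by positivity)]
  refine ENNReal.ofReal_le_ofReal ?_
  have hstep : |innerAverage n Cu G u x| ^ p * (1 - q) ^ p * (r ^ δ * d ^ (-δ)) ≤
      |U k - U (k + 1)| ^ p := by
    refine le_trans (le_of_eq ?_) (Real.rpow_le_rpow (by positivity) hk (by linarith))
    rw [Real.mul_rpow (by positivity) (by positivity),
      Real.mul_rpow (by positivity) (by positivity), hU0]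
    congr 1
    rw [Real.rpow_neg hd0.le, ← div_eq_mul_inv, ← Real.div_rpow hr0.le hd0.le]
    have : r / d = (2 : ℝ) ^ (-(k : ℝ)) := by
      simp only [hr, hρ]
      rw [Real.rpow_neg (by norm_num), Real.rpow_natCast]
      field_simp
    rw [this, hq, ← Real.rpow_natCast, ← Real.rpow_mul (by positivity),
      ← Real.rpow_mul (by positivity), ← Real.rpow_mul (by positivity)]
    congr 1
    field_simp
  refine le_trans (le_of_eq ?_) (mul_le_mul_of_nonneg_right (mul_le_mul_of_nonneg_right
    (mul_le_mul_of_nonneg_right hstep (by positivity)) (by positivity)) (by positivity))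
  have hpow : r ^ lam * r ^ e = r ^ n * r ^ n * (r ^ δ * r ^ δ) := by
    rw [← Real.rpow_natCast, ← Real.rpow_add hr0, ← Real.rpow_add hr0, ← Real.rpow_add hr0,
      ← Real.rpow_add hr0]
    congr 1
    rw [hlam, he]; ring
  rw [hρs, ← hr, Real.mul_rpow (by norm_num) hr0.le, Real.mul_rpow (by norm_num) hr0.le,
    Real.mul_rpow (by positivity) hr0.le, hc]
  have h3 : (3 : ℝ) ^ lam ≠ 0 := by positivity
  have h6' : (6 : ℝ) ^ e ≠ 0 := by positivity
  rw [show (β ^ 2 / 2) ^ n = β ^ n * (β / 2) ^ n by rw [← mul_pow]; ring,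
    show β * (r / 2) = (β / 2) * r by ring, mul_pow, mul_pow]
  set A := |innerAverage n Cu G u x| ^ p
  set Q := (1 - q) ^ p
  set D := d ^ (-δ)
  set M := (1 / (2 * Cu)) ^ δ
  calc _ = A * Q * D * M * ω ^ 2 * β ^ n * (β / 2) ^ n * (r ^ lam * r ^ e) := by
        field_simp
    _ = _ := by rw [hpow]; ring

/-- The averaged form of the pointwise Hardy inequality. -/
lemma exists_innerAverage_rpow_div_le {n : ℕ} {s p Cu δ C : ℝ} (hp : 1 < p) (hsp : 0 < s * p)
    (hspn : s * p < n) (hCu : 1 ≤ Cu) (hδ : 0 < δ) (hC : 0 < C) {G : Set (Euc n)}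
    (hG : IsUniformDomain n Cu G) (hne : (frontier G).Nonempty)
    (hdens : ∀ x ∈ G, ENNReal.ofReal
        (C * Metric.infDist x (frontier G) ^ ((n : ℝ) - s * p + 2 * δ)) ≤
      hContent n ((n : ℝ) - s * p + 2 * δ)
        (Metric.ball x (2 * Metric.infDist x (frontier G)) ∩ frontier G)) :
    ∃ c : ℝ, 0 < c ∧ ∀ u : Euc n → ℝ, Continuous u → ∀ η : ℝ, 0 < η →
      (∀ y, Metric.infDist y (frontier G) < η → u y = 0) → ∀ x ∈ G,
        ENNReal.ofReal (c * (|innerAverage n Cu G u x| ^ p /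
          Metric.infDist x (frontier G) ^ (s * p))) ≤
        ENNReal.ofReal (Metric.infDist x (frontier G) ^ (-((n : ℝ) + δ))) *
          ∫⁻ y in Metric.closedBall x (5 * Metric.infDist x (frontier G)) ∩ G,
            weightedDensity n s p δ G u y := by
  obtain ⟨c, hc, h⟩ := exists_radius_innerAverage_rpow_le hp hsp hCu hδ hG hne
  set lam := (n : ℝ) - s * p + 2 * δ with hlam
  have hlam0 : 0 < lam := by linarith
  refine ⟨c * C / 6 ^ lam, by positivity, fun u hu η hη huη x hx => ?_⟩
  set d := Metric.infDist x (frontier G) with hd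
  have hd0 : 0 < d := infDist_frontier_pos hG.1 hne hx
  set A := |innerAverage n Cu G u x| ^ p with hA
  have hA0 : 0 ≤ A := by positivity
  set ν := (volume.restrict G).withDensity (weightedDensity n s p δ G u) with hν
  have hνS : ∀ S, MeasurableSet S → ν S = ∫⁻ y in S ∩ G, weightedDensity n s p δ G u y :=
    fun S hS => by rw [hν, withDensity_apply _ hS, Measure.restrict_restrict hS]
  have hcov := mul_hContent_le_measure (n := n) hlam0
    (E := Metric.ball x (2 * d) ∩ frontier G) (S := Metric.closedBall x (5 * d)) ν
    (R := 3 * d) (t := ENNReal.ofReal (c * A * d ^ (-δ))) (by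
      intro w hw
      have hxw : dist x w < 2 * d := Metric.mem_ball'.1 hw.1
      obtain ⟨r, hr0, hr, hle⟩ := h u hu η hη huη x hx w hw.2 hxw
      refine ⟨r, hr0, hr, Metric.closedBall_subset_closedBall' ?_, ?_⟩
      · rw [dist_comm]; linarith
      · rw [hνS _ measurableSet_closedBall, ← ENNReal.ofReal_mul (by positivity)]
        refine le_trans (le_of_eq ?_) hle
        congr 1; ring)
  rw [hνS _ measurableSet_closedBall] at hcov
  have hle := (mul_le_mul_right (hdens x hx) (ENNReal.ofReal (c * A * d ^ (-δ)))).trans hcov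
  have h6 : ENNReal.ofReal (6 ^ lam) ≠ 0 := by
    rw [ENNReal.ofReal_ne_zero_iff]; positivity
  refine (ENNReal.mul_le_mul_iff_right h6 ENNReal.ofReal_ne_top).1 ?_
  rw [mul_left_comm]
  refine le_trans (le_of_eq ?_) (mul_le_mul_right hle _)
  rw [← ENNReal.ofReal_mul (by positivity), ← ENNReal.ofReal_mul (by positivity),
    ← ENNReal.ofReal_mul (by positivity)]
  congr 1
  have hpow : d ^ (-((n : ℝ) + δ)) * d ^ (-δ) * d ^ lam = (d ^ (s * p))⁻¹ := by
    rw [← Real.rpow_neg hd0.le, ← Real.rpow_add hd0, ← Real.rpow_add hd0]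
    congr 1
    rw [hlam]; ring
  calc _ = c * C * A * (d ^ (s * p))⁻¹ := by field_simp
    _ = _ := by rw [← hpow]; ring

/-- The oscillation part of the Hardy inequality. -/
lemma exists_abs_sub_innerAverage_rpow_div_le {n : ℕ} {s p Cu : ℝ} (hp : 1 < p)
    (hsp : 0 < s * p) (hCu : 1 ≤ Cu) {G : Set (Euc n)} (hG : IsOpen G)
    (hne : (frontier G).Nonempty) :
    ∃ c : ℝ, 0 < c ∧ ∀ u : Euc n → ℝ, Continuous u → ∀ x ∈ G,
      ENNReal.ofReal (c * (|u x - innerAverage n Cu G u x| ^ p /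
        Metric.infDist x (frontier G) ^ (s * p))) ≤ gagliardoDensity n s p G u x := by
  have hω0 := volume_real_unit_ball_pos n
  refine ⟨(1 / (4 * Cu)) ^ n * volume.real (Metric.ball (0 : Euc n) 1), by positivity,
    fun u hu x hx => ?_⟩
  set d := Metric.infDist x (frontier G) with hd
  have hd0 : 0 < d := infDist_frontier_pos hG hne hx
  have hβd : 1 / (4 * Cu) * d ≤ d :=
    mul_le_of_le_one_left hd0.le (by rw [div_le_one (by positivity)]; linarith)
  have h := abs_sub_average_rpow_le_gagliardoDensity hp hsp (G := G) hu x x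
    (r := 1 / (4 * Cu) * d) (K := d) (by positivity)
    ((Metric.ball_subset_ball hβd).trans (ball_infDist_frontier_subset hG hx))
    (fun y hy => (Metric.mem_ball'.1 hy).le.trans hβd)
  rw [volume_ball_eq _ (by positivity), ← ENNReal.ofReal_mul (by positivity)] at h
  have hde : ENNReal.ofReal (d ^ ((n : ℝ) + s * p)) ≠ 0 := by
    rw [ENNReal.ofReal_ne_zero_iff]; positivity
  refine (ENNReal.mul_le_mul_iff_right hde ENNReal.ofReal_ne_top).1 (le_trans (le_of_eq ?_) h)
  rw [← ENNReal.ofReal_mul (by positivity), Real.rpow_add hd0, Real.rpow_natCast, mul_pow]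
  congr 1
  simp only [innerAverage, ← hd]
  field_simp

lemma setLIntegral_mul_weightedDensity_le {n : ℕ} {s p δ A K : ℝ} (hA : 0 ≤ A) (hK : 0 ≤ K)
    {G : Set (Euc n)} {u : Euc n → ℝ} {y : Euc n}
    (h : ∫⁻ x, ENNReal.ofReal ((Metric.infDist y (frontier G) + dist x y) ^ (-((n : ℝ) + δ))) ≤
      ENNReal.ofReal (K * Metric.infDist y (frontier G) ^ (-δ)))
    (hy : 0 < Metric.infDist y (frontier G)) :
    ∫⁻ x in G, ENNReal.ofReal A *
        (ENNReal.ofReal ((Metric.infDist y (frontier G) + dist x y) ^ (-((n : ℝ) + δ))) *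
          weightedDensity n s p δ G u y) ≤
      ENNReal.ofReal (A * K) * gagliardoDensity n s p G u y := by
  unfold weightedDensity
  generalize Metric.infDist y (frontier G) = d at *
  generalize gagliardoDensity n s p G u y = g
  have hcancel : d ^ (-δ) * d ^ δ = 1 := by
    rw [← Real.rpow_add hy, neg_add_cancel, Real.rpow_zero]
  have hm : Measurable fun x : Euc n => ENNReal.ofReal ((d + dist x y) ^ (-((n : ℝ) + δ))) := by
    fun_prop
  rw [lintegral_const_mul' _ _ ENNReal.ofReal_ne_top, lintegral_mul_const _ hm]
  calc ENNReal.ofReal A *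
        ((∫⁻ x in G, ENNReal.ofReal ((d + dist x y) ^ (-((n : ℝ) + δ)))) *
          (g * ENNReal.ofReal (d ^ δ)))
      ≤ ENNReal.ofReal A * (ENNReal.ofReal (K * d ^ (-δ)) * (g * ENNReal.ofReal (d ^ δ))) := by
        gcongr
        exact (setLIntegral_le_lintegral _ _).trans h
    _ = ENNReal.ofReal A * (ENNReal.ofReal (K * d ^ (-δ)) * ENNReal.ofReal (d ^ δ)) * g := by
        ring
    _ = ENNReal.ofReal (A * K) * g := by
        rw [← ENNReal.ofReal_mul (by positivity), mul_assoc K, hcancel, mul_one,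
          ← ENNReal.ofReal_mul hA]

/-- Integrating the averaged pointwise Hardy inequality by Tonelli's theorem. -/
lemma exists_lintegral_weightedDensity_le {n : ℕ} {s p δ : ℝ} (hδ : 0 < δ) {G : Set (Euc n)}
    (hG : IsOpen G) (hne : (frontier G).Nonempty) :
    ∃ K : ℝ, 0 ≤ K ∧ ∀ u : Euc n → ℝ, Continuous u →
      ∫⁻ x in G, ENNReal.ofReal (Metric.infDist x (frontier G) ^ (-((n : ℝ) + δ))) *
          ∫⁻ y in Metric.closedBall x (5 * Metric.infDist x (frontier G)) ∩ G,
            weightedDensity n s p δ G u y ≤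
        ENNReal.ofReal K * ∫⁻ x in G, gagliardoDensity n s p G u x := by
  obtain ⟨K, hK, h⟩ := exists_lintegral_add_dist_rpow_le n hδ
  refine ⟨11 ^ ((n : ℝ) + δ) * K, by positivity, fun u hu => ?_⟩
  set d : Euc n → ℝ := fun x => Metric.infDist x (frontier G) with hd
  have hd0 : ∀ x ∈ G, 0 < d x := fun x hx => infDist_frontier_pos hG hne hx
  have hdm : Measurable d := measurable_infDist
  have hWm : Measurable (weightedDensity n s p δ G u) :=
    (measurable_gagliardoDensity hu).mul (hdm.pow_const δ).ennreal_ofReal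
  have hkm : Measurable fun z : Euc n × Euc n =>
      ENNReal.ofReal ((d z.2 + dist z.1 z.2) ^ (-((n : ℝ) + δ))) :=
    (((hdm.comp measurable_snd).add continuous_dist.measurable).pow_const _).ennreal_ofReal
  calc _ ≤ ∫⁻ x in G, ∫⁻ y in G, ENNReal.ofReal (11 ^ ((n : ℝ) + δ)) *
          (ENNReal.ofReal ((d y + dist x y) ^ (-((n : ℝ) + δ))) *
            weightedDensity n s p δ G u y) := by
        refine setLIntegral_mono' hG.measurableSet fun x hx => ?_
        rw [← lintegral_const_mul _ hWm]
        refine (setLIntegral_mono' (measurableSet_closedBall.inter hG.measurableSet)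
          fun y hy => ?_).trans (lintegral_mono_set inter_subset_right)
        rw [← mul_assoc, ← ENNReal.ofReal_mul (by positivity)]
        gcongr
        have hxy : dist x y ≤ 5 * d x := Metric.mem_closedBall'.1 hy.1
        have h1 : d y ≤ d x + dist y x := Metric.infDist_le_infDist_add_dist
        rw [dist_comm y x] at h1
        have hx0 := hd0 x hx
        have hy0 := hd0 y hy.2
        calc d x ^ (-((n : ℝ) + δ)) = 11 ^ ((n : ℝ) + δ) * (11 * d x) ^ (-((n : ℝ) + δ)) := by
              rw [Real.mul_rpow (by norm_num) hx0.le, ← mul_assoc, ← Real.rpow_add (by norm_num)]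
              simp
          _ ≤ _ := by
              gcongr ?_ * ?_
              refine Real.rpow_le_rpow_of_nonpos (add_pos_of_pos_of_nonneg hy0 dist_nonneg)
                (by linarith) ?_
              have : (0 : ℝ) ≤ n := n.cast_nonneg
              linarith
    _ = ∫⁻ y in G, ∫⁻ x in G, ENNReal.ofReal (11 ^ ((n : ℝ) + δ)) *
          (ENNReal.ofReal ((d y + dist x y) ^ (-((n : ℝ) + δ))) *
            weightedDensity n s p δ G u y) :=
        lintegral_lintegral_swap ((hkm.mul (hWm.comp measurable_snd)).const_mul _).aemeasurable
    _ ≤ ∫⁻ y in G, ENNReal.ofReal (11 ^ ((n : ℝ) + δ) * K) * gagliardoDensity n s p G u y :=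
        setLIntegral_mono' hG.measurableSet fun y hy =>
          setLIntegral_mul_weightedDensity_le (by positivity) hK (h (d y) (hd0 y hy) y) (hd0 y hy)
    _ = _ := lintegral_const_mul _ (measurable_gagliardoDensity hu)

lemma abs_rpow_le_two_rpow_mul {p : ℝ} (hp : 0 ≤ p) (a b : ℝ) :
    |a| ^ p ≤ 2 ^ p * (|a - b| ^ p + |b| ^ p) := by
  have h1 : |a| ≤ 2 * max |a - b| |b| := by
    have := abs_add_le (a - b) b
    rw [sub_add_cancel] at this
    linarith [le_max_left |a - b| |b|, le_max_right |a - b| |b|]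
  calc |a| ^ p ≤ (2 * max |a - b| |b|) ^ p := by gcongr
    _ = 2 ^ p * (max |a - b| |b|) ^ p := Real.mul_rpow (by norm_num) (by positivity)
    _ ≤ _ := by
        gcongr
        rcases max_cases |a - b| |b| with ⟨h, -⟩ | ⟨h, -⟩ <;> rw [h]
        · exact le_add_of_nonneg_right (by positivity)
        · exact le_add_of_nonneg_left (by positivity)

/-- If `0<s<1`, `1<p<∞`, `0<sp<n`, `G` is a uniform domain and there are
`n-sp < λ ≤ n` and `C > 0` with `H^λ_∞(B(x,2 dist(x,∂G)) ∩ ∂G) ≥ C dist(x,∂G)^λ`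
for all `x ∈ G`, then `G` admits the `(s,p)`-Hardy inequality. -/
theorem statement1 (n : ℕ) (s p : ℝ) (hs0 : 0 < s) (hs1 : s < 1) (hp1 : 1 < p)
    (hsp0 : 0 < s * p) (hspn : s * p < n)
    (G : Set (Euc n)) (hGproper : G ≠ Set.univ)
    (Cu : ℝ) (hCu : 1 ≤ Cu) (hunif : IsUniformDomain n Cu G)
    (lam C : ℝ) (hlam1 : (n : ℝ) - s * p < lam) (hlam2 : lam ≤ n) (hC : 0 < C)
    (hdens : ∀ x ∈ G, ENNReal.ofReal (C * Metric.infDist x (frontier G) ^ lam) ≤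
      hContent n lam (Metric.ball x (2 * Metric.infDist x (frontier G)) ∩ frontier G)) :
    AdmitsHardy n s p G := by
  set δ := (lam - (n - s * p)) / 2 with hδ
  have hδ0 : 0 < δ := by rw [hδ]; linarith
  have hlam : lam = (n : ℝ) - s * p + 2 * δ := by rw [hδ]; ring
  have hG := hunif.1
  have hne : (frontier G).Nonempty := nonempty_frontier_iff.2 ⟨hunif.2.1.nonempty, hGproper⟩
  rw [hlam] at hdens
  obtain ⟨c₁, hc₁, h₁⟩ := exists_abs_sub_innerAverage_rpow_div_le hp1 hsp0 hCu hG hne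
  obtain ⟨c₂, hc₂, h₂⟩ :=
    exists_innerAverage_rpow_div_le hp1 hsp0 hspn hCu hδ0 hC hunif hne hdens
  obtain ⟨K, hK, h₃⟩ := exists_lintegral_weightedDensity_le (s := s) (p := p) hδ0 hG hne
  refine ⟨2 ^ p / c₁ + 2 ^ p / c₂ * K, by positivity, fun u hu hcu hsu => ?_⟩
  obtain ⟨η, hη, huη⟩ := exists_eq_zero_near_frontier hG hne hcu hsu
  have huc := hu.continuous
  set g := gagliardoDensity n s p G u with hg
  have hgm : Measurable g := measurable_gagliardoDensity huc
  set d : Euc n → ℝ := fun x => Metric.infDist x (frontier G) with hd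
  set W : Euc n → ℝ≥0∞ := fun x => ENNReal.ofReal (d x ^ (-((n : ℝ) + δ))) *
    ∫⁻ y in Metric.closedBall x (5 * d x) ∩ G, weightedDensity n s p δ G u y with hW
  calc ∫⁻ x in G, ENNReal.ofReal (|u x| ^ p / d x ^ (s * p))
      ≤ ∫⁻ x in G, (ENNReal.ofReal (2 ^ p / c₁) * g x + ENNReal.ofReal (2 ^ p / c₂) * W x) := by
        refine setLIntegral_mono' hG.measurableSet fun x hx => ?_
        have hx0 : 0 < d x := infDist_frontier_pos hG hne hx
        refine le_trans ?_ (add_le_add (mul_le_mul_right (h₁ u huc x hx) _)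
          (mul_le_mul_right (h₂ u huc η hη huη x hx) _))
        rw [← ENNReal.ofReal_mul (by positivity), ← ENNReal.ofReal_mul (by positivity),
          ← ENNReal.ofReal_add (by positivity) (by positivity)]
        refine ENNReal.ofReal_le_ofReal ?_
        have := abs_rpow_le_two_rpow_mul (p := p) (by linarith) (u x) (innerAverage n Cu G u x)
        calc |u x| ^ p / d x ^ (s * p) ≤ 2 ^ p * (|u x - innerAverage n Cu G u x| ^ p +
              |innerAverage n Cu G u x| ^ p) / d x ^ (s * p) := by gcongr
          _ = _ := by
            simp only [hd] at hx0 ⊢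
            field_simp
    _ = ENNReal.ofReal (2 ^ p / c₁) * (∫⁻ x in G, g x) +
          ENNReal.ofReal (2 ^ p / c₂) * ∫⁻ x in G, W x := by
        rw [lintegral_add_left (hgm.const_mul _), lintegral_const_mul _ hgm,
          lintegral_const_mul' _ _ ENNReal.ofReal_ne_top]
    _ ≤ ENNReal.ofReal (2 ^ p / c₁) * (∫⁻ x in G, g x) +
          ENNReal.ofReal (2 ^ p / c₂) * (ENNReal.ofReal K * ∫⁻ x in G, g x) := by
        gcongr
        exact h₃ u huc
    _ = ENNReal.ofReal (2 ^ p / c₁ + 2 ^ p / c₂ * K) * ∫⁻ x in G, g x := by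
        rw [ENNReal.ofReal_add (by positivity) (by positivity),
          ENNReal.ofReal_mul (by positivity)]
        ring

end
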